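/- arXiv:1507.01219 — 2 statements merged into one kernel-verified Lean document; each statement's English description precedes it below -/
import Mathlib

section
/- The Fourier transform F : L¹(𝕋) → c₀(ℤ), f ↦ (f̂(n))_{n∈ℤ}, is injective, contractive, and not surjective. -/
open MeasureTheory Filter AddCircle

open scoped ZeroAtInfty Topology

namespace MeasureTheory.L1

variable {α : Type*} [MeasurableSpace α] {μ : Measure α}

theorem norm_integral_mul_le {g : α → ℂ} {M : ℝ} (hM : ∀ x, ‖g x‖ ≤ M) (f : Lp ℂ 1 μ) :
    ‖∫ x, g x * f x ∂μ‖ ≤ M * ‖f‖ := by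
  rw [norm_eq_integral_norm, ← integral_const_mul]
  refine norm_integral_le_of_norm_le ((L1.integrable_coeFn f).norm.const_mul M)
    (ae_of_all _ fun x ↦ ?_)
  rw [norm_mul]
  gcongr
  exact hM x

/-- Integration against a bounded function, as a continuous linear functional on `L¹`. -/
noncomputable def integralMul (g : α → ℂ) (hg : AEStronglyMeasurable g μ) (M : ℝ)
    (hM : ∀ x, ‖g x‖ ≤ M) : Lp ℂ 1 μ →L[ℂ] ℂ :=
  have integrable_mul (f : Lp ℂ 1 μ) : Integrable (fun x ↦ g x * f x) μ :=
    (L1.integrable_coeFn f).bdd_mul hg (ae_of_all _ hM)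
  LinearMap.mkContinuous
    { toFun := fun f ↦ ∫ x, g x * f x ∂μ
      map_add' := fun f₁ f₂ ↦ by
        rw [← MeasureTheory.integral_add (integrable_mul f₁) (integrable_mul f₂)]
        refine integral_congr_ae ?_
        filter_upwards [Lp.coeFn_add f₁ f₂] with x hx
        rw [hx, Pi.add_apply, mul_add]
      map_smul' := fun c f ↦ by
        rw [RingHom.id_apply, smul_eq_mul, ← integral_const_mul]
        refine integral_congr_ae ?_
        filter_upwards [Lp.coeFn_smul c f] with x hx
        rw [hx, Pi.smul_apply, smul_eq_mul, mul_left_comm] }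
    M (norm_integral_mul_le hM)

theorem integralMul_apply (g : α → ℂ) (hg : AEStronglyMeasurable g μ) (M : ℝ)
    (hM : ∀ x, ‖g x‖ ≤ M) (f : Lp ℂ 1 μ) :
    integralMul g hg M hM f = ∫ x, g x * f x ∂μ := rfl

end MeasureTheory.L1

/-- An integrable function on a compact metrizable space whose integral against every
continuous function vanishes is zero almost everywhere. -/
theorem MeasureTheory.Integrable.ae_eq_zero_of_forall_integral_continuousMap_mul_eq_zero
    {X : Type*} [PseudoEMetricSpace X] [CompactSpace X] [MeasurableSpace X] [BorelSpace X]
    {μ : Measure X} {f : X → ℂ} (hf : Integrable f μ)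
    (h : ∀ g : C(X, ℂ), ∫ x, g x * f x ∂μ = 0) : f =ᵐ[μ] 0 := by
  refine ae_eq_zero_of_forall_setIntegral_isClosed_eq_zero hf fun s hs ↦ ?_
  have hpos (n : ℕ) : (0 : ℝ) < 1 / ((n : ℝ) + 1) := Nat.one_div_pos_of_nat
  have hlim := thickenedIndicator_tendsto_indicator_closure hpos
    tendsto_one_div_add_atTop_nhds_zero_nat s
  rw [hs.closure_eq, tendsto_pi_nhds] at hlim
  let g (n : ℕ) : C(X, ℂ) :=
    ⟨fun x ↦ ((thickenedIndicator (hpos n) s x : ℝ) : ℂ), by fun_prop⟩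
  have key : Tendsto (fun n ↦ ∫ x, g n x * f x ∂μ) atTop (𝓝 (∫ x, s.indicator f x ∂μ)) := by
    refine tendsto_integral_of_dominated_convergence (fun x ↦ ‖f x‖)
      (fun n ↦ (g n).continuous.aestronglyMeasurable.mul hf.1) hf.norm
      (fun n ↦ ae_of_all _ fun x ↦ ?_) (ae_of_all _ fun x ↦ ?_)
    · rw [norm_mul]
      refine mul_le_of_le_one_left (norm_nonneg _) ?_
      simpa [g] using thickenedIndicator_le_one (hpos n) s x
    · have hx : Tendsto (fun n ↦ g n x) atTop
          (𝓝 (((s.indicator (fun _ ↦ (1 : NNReal)) x : NNReal) : ℝ) : ℂ)) :=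
        (Complex.continuous_ofReal.tendsto _).comp
          ((NNReal.continuous_coe.tendsto _).comp (hlim x))
      convert hx.mul_const (f x) using 2
      by_cases hxs : x ∈ s <;> simp [hxs]
  simp only [h, integral_indicator hs.measurableSet] at key
  exact tendsto_nhds_unique key tendsto_const_nhds

namespace AddCircle

theorem norm_fourier_apply {T : ℝ} (n : ℤ) (x : AddCircle T) : ‖fourier n x‖ = 1 := by
  rw [fourier_apply, Circle.norm_coe]

variable {T : ℝ} [hT : Fact (0 < T)]

/-- The `n`-th Fourier coefficient as a continuous linear functional on `L¹`. -/
noncomputable def fourierCoeffL1 (n : ℤ) : Lp ℂ 1 (@haarAddCircle T hT) →L[ℂ] ℂ :=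
  L1.integralMul (fourier (-n)) (fourier (-n)).continuous.aestronglyMeasurable 1
    fun x ↦ (norm_fourier_apply (-n) x).le

theorem fourierCoeffL1_apply (n : ℤ) (f : Lp ℂ 1 (@haarAddCircle T hT)) :
    fourierCoeffL1 n f = fourierCoeff f n := rfl

theorem norm_fourierCoeffL1_le (n : ℤ) (f : Lp ℂ 1 (@haarAddCircle T hT)) :
    ‖fourierCoeffL1 n f‖ ≤ ‖f‖ :=
  (L1.norm_integral_mul_le (fun x ↦ (norm_fourier_apply (-n) x).le) f).trans_eq (one_mul _)

theorem fourierCoeffL1_fourierLp (n m : ℤ) :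
    fourierCoeffL1 n (@fourierLp T hT 1 _ m) = (Pi.single m 1 : ℤ → ℂ) n := by
  rw [fourierCoeffL1_apply, fourierCoeff_congr_ae (coeFn_fourierLp 1 m), fourierCoeff_fourier]

/-- The Riemann–Lebesgue lemma on the circle. -/
theorem tendsto_fourierCoeffL1 (f : Lp ℂ 1 (@haarAddCircle T hT)) :
    Tendsto (fun n ↦ fourierCoeffL1 n f) cofinite (𝓝 0) := by
  have hspan : ∀ p ∈ Submodule.span ℂ (Set.range (@fourierLp T hT 1 _)),
      Tendsto (fun n ↦ fourierCoeffL1 n p) cofinite (𝓝 0) := by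
    intro p hp
    induction hp using Submodule.span_induction with
    | mem p hp =>
      obtain ⟨m, rfl⟩ := hp
      refine tendsto_const_nhds.congr' ?_
      filter_upwards [(Set.finite_singleton m).compl_mem_cofinite] with n hn
      rw [fourierCoeffL1_fourierLp, Pi.single_eq_of_ne hn]
    | zero => simp
    | add p q _ _ hp hq => simpa using hp.add hq
    | smul c p _ hp => simpa using hp.const_mul c
  have hf : f ∈ closure (Submodule.span ℂ (Set.range (@fourierLp T hT 1 _)) : Set _) := by
    rw [← Submodule.topologicalClosure_coe, span_fourierLp_closure_eq_top ENNReal.one_ne_top]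
    trivial
  rw [Metric.tendsto_nhds]
  intro ε hε
  obtain ⟨p, hp, hfp⟩ := Metric.mem_closure_iff.1 hf (ε / 2) (half_pos hε)
  filter_upwards [Metric.tendsto_nhds.1 (hspan p hp) (ε / 2) (half_pos hε)] with n hn
  have hle := norm_fourierCoeffL1_le n (f - p)
  rw [map_sub] at hle
  rw [dist_eq_norm] at hfp
  rw [dist_zero_right] at hn ⊢
  linarith [norm_le_norm_sub_add (fourierCoeffL1 n f) (fourierCoeffL1 n p)]

/-- An `L¹` function on the circle all of whose Fourier coefficients vanish is zero. -/
theorem eq_zero_of_fourierCoeffL1_eq_zero (f : Lp ℂ 1 (@haarAddCircle T hT))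
    (hf : ∀ n, fourierCoeffL1 n f = 0) : f = 0 := by
  have hint (g : C(AddCircle T, ℂ)) : Integrable (fun x ↦ g x * f x) haarAddCircle :=
    (L1.integrable_coeFn f).bdd_mul g.continuous.aestronglyMeasurable
      (ae_of_all _ g.norm_coe_le_norm)
  rw [Lp.eq_zero_iff_ae_eq_zero]
  refine (L1.integrable_coeFn f).ae_eq_zero_of_forall_integral_continuousMap_mul_eq_zero
    fun g ↦ ?_
  have hspan : ∀ p ∈ Submodule.span ℂ (Set.range (@fourier T)),
      ∫ x, p x * f x ∂haarAddCircle = 0 := by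
    intro p hp
    induction hp using Submodule.span_induction with
    | mem p hp =>
      obtain ⟨m, rfl⟩ := hp
      simpa [fourierCoeffL1_apply, fourierCoeff] using hf (-m)
    | zero => simp
    | add p q _ _ hp hq =>
      simp only [ContinuousMap.add_apply, add_mul]
      rw [integral_add (hint p) (hint q), hp, hq, add_zero]
    | smul c p _ hp =>
      simp only [ContinuousMap.smul_apply, smul_eq_mul, mul_assoc]
      rw [integral_const_mul, hp, mul_zero]
  have hg : g ∈ closure (Submodule.span ℂ (Set.range (@fourier T)) : Set _) := by
    rw [← Submodule.topologicalClosure_coe, span_fourier_closure_eq_top]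
    trivial
  refine norm_le_zero_iff.1 (le_of_forall_pos_le_add fun ε hε ↦ ?_)
  have hδ : 0 < ε / (‖f‖ + 1) := by positivity
  obtain ⟨p, hp, hgp⟩ := Metric.mem_closure_iff.1 hg _ hδ
  rw [dist_eq_norm, lt_div_iff₀ (by positivity)] at hgp
  have hle := L1.norm_integral_mul_le (g - p).norm_coe_le_norm f
  simp only [ContinuousMap.sub_apply, sub_mul] at hle
  rw [integral_sub (hint g) (hint p), hspan p hp, sub_zero] at hle
  nlinarith [norm_nonneg (g - p)]

/-- The Fourier transform as a continuous linear map from `L¹` of the circle to `c₀(ℤ)`. -/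
noncomputable def fourierTransformL1 : Lp ℂ 1 (@haarAddCircle T hT) →L[ℂ] C₀(ℤ, ℂ) :=
  LinearMap.mkContinuous
    { toFun := fun f ↦
        { toFun := fun n ↦ fourierCoeffL1 n f
          continuous_toFun := continuous_of_discreteTopology
          zero_at_infty' := by
            rw [cocompact_eq_cofinite]
            exact tendsto_fourierCoeffL1 f }
      map_add' := fun f g ↦ by ext n; exact map_add (fourierCoeffL1 n) f g
      map_smul' := fun c f ↦ by ext n; exact map_smul (fourierCoeffL1 n) c f }
    1 fun f ↦ by
      rw [one_mul, ← ZeroAtInftyContinuousMap.norm_toBCF_eq_norm]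
      exact (BoundedContinuousFunction.norm_le (norm_nonneg f)).2 (norm_fourierCoeffL1_le · f)

theorem fourierTransformL1_apply (f : Lp ℂ 1 (@haarAddCircle T hT)) (n : ℤ) :
    fourierTransformL1 f n = fourierCoeffL1 n f := rfl

theorem fourierTransformL1_injective :
    Function.Injective (fourierTransformL1 : Lp ℂ 1 (@haarAddCircle T hT) → C₀(ℤ, ℂ)) :=
  (injective_iff_map_eq_zero _).2 fun f hf ↦
    eq_zero_of_fourierCoeffL1_eq_zero f fun n ↦ DFunLike.congr_fun hf n

/-- If the Fourier transform were onto `c₀(ℤ)`, then by duality every bounded function would have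
absolutely summable Fourier coefficients. -/
theorem summable_norm_fourierCoeff_of_surjective
    (hsurj : Function.Surjective (fourierTransformL1 : Lp ℂ 1 (@haarAddCircle T hT) → C₀(ℤ, ℂ)))
    {g : AddCircle T → ℂ} (hg : AEStronglyMeasurable g haarAddCircle) {M : ℝ}
    (hM : ∀ x, ‖g x‖ ≤ M) : Summable fun n ↦ ‖fourierCoeff g n‖ := by
  obtain ⟨C, hC, hpre⟩ := fourierTransformL1.exists_preimage_norm_le hsurj
  have hM₀ : 0 ≤ M := (norm_nonneg _).trans (hM 0)
  refine summable_of_sum_le (c := M * C) (fun _ ↦ norm_nonneg _) fun S ↦ ?_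
  choose c hc hcg using fun n ↦ RCLike.exists_norm_eq_mul_self (fourierCoeff g n)
  let p : Lp ℂ 1 (@haarAddCircle T hT) := ∑ n ∈ S, c n • fourierLp 1 (-n)
  have hp_coeff : ‖fourierTransformL1 p‖ ≤ 1 := by
    rw [← ZeroAtInftyContinuousMap.norm_toBCF_eq_norm]
    refine (BoundedContinuousFunction.norm_le zero_le_one).2 fun n ↦ ?_
    change ‖fourierCoeffL1 n p‖ ≤ 1
    have : fourierCoeffL1 n p = if -n ∈ S then c (-n) else 0 := by
      simp only [p, map_sum, map_smul, fourierCoeffL1_fourierLp, Pi.single_apply, smul_eq_mul,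
        mul_ite, mul_one, mul_zero, ← neg_eq_iff_eq_neg, Finset.sum_ite_eq]
    rw [this]
    split_ifs <;> simp [hc]
  have hp_norm : ‖p‖ ≤ C := by
    obtain ⟨q, hq, hqC⟩ := hpre (fourierTransformL1 p)
    rw [← fourierTransformL1_injective hq]
    exact hqC.trans (mul_le_of_le_one_right hC.le hp_coeff)
  have hpair (n : ℤ) : L1.integralMul g hg M hM (fourierLp 1 (-n)) = fourierCoeff g n := by
    rw [L1.integralMul_apply, fourierCoeff]
    refine integral_congr_ae ?_
    filter_upwards [coeFn_fourierLp 1 (-n)] with x hx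
    rw [hx, smul_eq_mul, mul_comm]
  have hsum : ((∑ n ∈ S, ‖fourierCoeff g n‖ : ℝ) : ℂ) = ∫ x, g x * p x ∂haarAddCircle := by
    rw [← L1.integralMul_apply g hg M hM]
    simp only [p, map_sum, map_smul, hpair, smul_eq_mul, Complex.ofReal_sum]
    exact Finset.sum_congr rfl fun n _ ↦ hcg n
  calc ∑ n ∈ S, ‖fourierCoeff g n‖ ≤ ‖((∑ n ∈ S, ‖fourierCoeff g n‖ : ℝ) : ℂ)‖ := by
        rw [Complex.norm_real]; exact le_abs_self _
    _ ≤ M * ‖p‖ := by rw [hsum]; exact L1.norm_integral_mul_le hM p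
    _ ≤ M * C := by gcongr

/-- The sawtooth function on the circle has Fourier coefficients of size `T / (2π|n|)`. -/
theorem norm_fourierCoeff_liftIoc_ofReal {n : ℤ} (hn : n ≠ 0) :
    ‖fourierCoeff (liftIoc T 0 fun x : ℝ ↦ (x : ℂ)) n‖ = T / (2 * Real.pi) * |(n : ℝ)|⁻¹ := by
  have hconst : fourierCoeffOn (lt_add_of_pos_right 0 hT.out) (fun _ ↦ (1 : ℂ)) n = 0 := by
    rw [← fourierCoeff_liftIoc_eq]
    have : (liftIoc T 0 fun _ : ℝ ↦ (1 : ℂ)) = fourier 0 := by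
      ext x
      rw [fourier_zero]
      rfl
    rw [this, fourierCoeff_fourier, Pi.single_eq_of_ne hn]
  have hderiv (x : ℝ) : HasDerivAt (fun x : ℝ ↦ (x : ℂ)) 1 x := Complex.ofRealCLM.hasDerivAt
  rw [fourierCoeff_liftIoc_eq, fourierCoeffOn_of_hasDerivAt _ hn (fun x _ ↦ hderiv x) (by simp),
    hconst, norm_mul, mul_zero, sub_zero, norm_mul, norm_fourier_apply]
  simp [abs_of_pos hT.out, abs_of_pos Real.pi_pos]
  ring

theorem fourierTransformL1_not_surjective :
    ¬ Function.Surjective (fourierTransformL1 : Lp ℂ 1 (@haarAddCircle T hT) → C₀(ℤ, ℂ)) := by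
  intro hsurj
  have hmeas : Measurable (liftIoc T 0 fun x : ℝ ↦ (x : ℂ)) :=
    Complex.measurable_ofReal.comp
      (measurable_subtype_coe.comp (measurableEquivIoc T 0).measurable)
  have hbound (x : AddCircle T) : ‖liftIoc T 0 (fun x : ℝ ↦ (x : ℂ)) x‖ ≤ T := by
    have hx := (equivIoc T 0 x).2
    change ‖((equivIoc T 0 x : ℝ) : ℂ)‖ ≤ T
    rw [Complex.norm_real, Real.norm_of_nonneg hx.1.le]
    simpa using hx.2
  have hsum := summable_norm_fourierCoeff_of_surjective hsurj hmeas.aestronglyMeasurable hbound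
  have hnat := (summable_nat_add_iff 1).2 (hsum.comp_injective Nat.cast_injective)
  refine Real.not_summable_natCast_inv ((summable_nat_add_iff 1).1 ?_)
  have hT₀ := hT.out
  refine (summable_mul_left_iff (a := T / (2 * Real.pi)) (by positivity)).1 (hnat.congr fun k ↦ ?_)
  rw [Function.comp_apply, norm_fourierCoeff_liftIoc_ofReal (by positivity)]
  simp [abs_of_nonneg (by positivity : (0 : ℝ) ≤ (k : ℝ) + 1)]

end AddCircle

/-- The Fourier transform `F : L¹(𝕋) → c₀(ℤ)`, `f ↦ (f̂(n))ₙ`, is injective and contractive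
(mapping into `c₀(ℤ)`), but not surjective. Here `𝕋 = ℝ/2πℤ` carries its normalized Haar
measure. -/
theorem fourier_transform_L1_injective_contractive_not_surjective
    [hT : Fact (0 < 2 * Real.pi)] :
    (∀ f : Lp ℂ 1 (@haarAddCircle (2 * Real.pi) hT),
        Tendsto (fun n : ℤ => fourierCoeff (f : AddCircle (2 * Real.pi) → ℂ) n)
          cofinite (nhds 0)) ∧
    (∀ f g : Lp ℂ 1 (@haarAddCircle (2 * Real.pi) hT),
        (∀ n : ℤ, fourierCoeff (f : AddCircle (2 * Real.pi) → ℂ) n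
            = fourierCoeff (g : AddCircle (2 * Real.pi) → ℂ) n) → f = g) ∧
    (∀ (f : Lp ℂ 1 (@haarAddCircle (2 * Real.pi) hT)) (n : ℤ),
        ‖fourierCoeff (f : AddCircle (2 * Real.pi) → ℂ) n‖ ≤ ‖f‖) ∧
    (∃ a : ℤ → ℂ, Tendsto a cofinite (nhds 0) ∧
        ∀ f : Lp ℂ 1 (@haarAddCircle (2 * Real.pi) hT),
          ∃ n : ℤ, fourierCoeff (f : AddCircle (2 * Real.pi) → ℂ) n ≠ a n) := by
  refine ⟨tendsto_fourierCoeffL1, fun f g h ↦ fourierTransformL1_injective ?_, fun f n ↦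
    norm_fourierCoeffL1_le n f, ?_⟩
  · ext n
    exact h n
  · obtain ⟨a, ha⟩ := not_forall.1 (fourierTransformL1_not_surjective (hT := hT))
    refine ⟨a, ?_, fun f ↦ ?_⟩
    · simpa only [cocompact_eq_cofinite] using zero_at_infty a
    · by_contra! h
      exact ha ⟨f, ZeroAtInftyContinuousMap.ext h⟩
end

section
/- Let (Ω, μ) be a probability space and (f_i)_{i≥1} ⊆ L^∞(μ) an orthonormal system in L²(μ) with K = sup_i ‖f_i‖_∞ < ∞. Then for every 2 < p < ∞ there exist an infinite subsequence (f_{i_k})_{k≥1} and a constant C > 0 such that for all finitely supported complex sequences (c_k): ‖∑_k c_k f_{i_k}‖_{L^p(μ)} ≤ C·(∑_k |c_k|²)^{1/2}. -/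
open MeasureTheory
open scoped ENNReal
open Filter Topology ComplexConjugate

namespace LambdaP

/-- Second-order expansion of `‖z + w‖ ^ (2 * (m + 1))` around `z`. -/
theorem norm_add_pow_le (z w : ℂ) (m : ℕ) :
    ‖z + w‖ ^ (2 * (m + 1)) ≤ ‖z‖ ^ (2 * (m + 1))
      + 2 * (m + 1) * (‖z‖ ^ (2 * m) * (conj z * w).re)
      + 3 * (m + 1) ^ 2 * ‖w‖ ^ 2 * (‖z‖ + ‖w‖) ^ (2 * m) := by
  have hsq : ‖z + w‖ ^ 2 = ‖z‖ ^ 2 + 2 * (conj z * w).re + ‖w‖ ^ 2 := by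
    simp only [Complex.sq_norm, Complex.normSq_apply, Complex.add_re, Complex.add_im,
      Complex.mul_re, Complex.conj_re, Complex.conj_im]
    ring
  have hre : |(conj z * w).re| ≤ ‖z‖ * ‖w‖ := by
    simpa using Complex.abs_re_le_norm (conj z * w)
  have hz := norm_nonneg z
  have hw := norm_nonneg w
  generalize (conj z * w).re = t at hsq hre
  generalize ‖z‖ = a at *
  generalize ‖w‖ = b at *
  have hab : a ≤ a + b := by linarith
  have hba : b ≤ a + b := by linarith
  induction m with
  | zero =>
    simp only [zero_add, mul_one, CharP.cast_eq_zero, mul_zero, pow_zero, hsq]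
    nlinarith [sq_nonneg b]
  | succ m ih =>
    have hmul := mul_le_mul_of_nonneg_right ih (sq_nonneg ‖z + w‖)
    have hsq_le : ‖z + w‖ ^ 2 ≤ (a + b) ^ 2 := by
      rw [hsq]; nlinarith [le_abs_self t]
    have hlast : 3 * ((m : ℝ) + 1) ^ 2 * b ^ 2 * (a + b) ^ (2 * m) * ‖z + w‖ ^ 2
        ≤ 3 * ((m : ℝ) + 1) ^ 2 * b ^ 2 * (a + b) ^ (2 * m) * (a + b) ^ 2 := by gcongr
    have hpow : a ^ (2 * m) ≤ (a + b) ^ (2 * m) := by gcongr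
    have htsq : t ^ 2 ≤ b ^ 2 * (a + b) ^ 2 := by
      rw [← sq_abs]
      calc |t| ^ 2 ≤ (a * b) ^ 2 := by gcongr
        _ = b ^ 2 * a ^ 2 := by ring
        _ ≤ b ^ 2 * (a + b) ^ 2 := by gcongr
    have htb : t * b ^ 2 ≤ b ^ 2 * (a + b) ^ 2 := by
      calc t * b ^ 2 ≤ (a * b) * b ^ 2 := by gcongr; exact (le_abs_self t).trans hre
        _ = b ^ 2 * (a * b) := by ring
        _ ≤ b ^ 2 * (a + b) ^ 2 := by gcongr; nlinarith
    have haa : a ^ 2 * b ^ 2 ≤ b ^ 2 * (a + b) ^ 2 := by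
      rw [mul_comm]; gcongr
    have hcross : a ^ (2 * m) * (a ^ 2 * b ^ 2 + 4 * (m + 1) * t ^ 2 + 2 * (m + 1) * (t * b ^ 2))
        ≤ (a + b) ^ (2 * m) * ((6 * m + 7) * (b ^ 2 * (a + b) ^ 2)) := by
      have hle : a ^ 2 * b ^ 2 + 4 * (m + 1) * t ^ 2 + 2 * (m + 1) * (t * b ^ 2)
          ≤ (6 * m + 7) * (b ^ 2 * (a + b) ^ 2) := by
        have h₁ := mul_le_mul_of_nonneg_left htsq (by positivity : (0 : ℝ) ≤ 4 * (m + 1))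
        have h₂ := mul_le_mul_of_nonneg_left htb (by positivity : (0 : ℝ) ≤ 2 * (m + 1))
        linarith
      calc _ ≤ a ^ (2 * m) * ((6 * m + 7) * (b ^ 2 * (a + b) ^ 2)) := by gcongr
        _ ≤ _ := by gcongr
    have hslack : 0 ≤ (a + b) ^ (2 * m) * (b ^ 2 * (a + b) ^ 2) := by positivity
    have hexpand : (a ^ (2 * (m + 1)) + 2 * ((m : ℝ) + 1) * (a ^ (2 * m) * t)) * ‖z + w‖ ^ 2
        = a ^ (2 * (m + 1 + 1)) + 2 * ((m : ℝ) + 1 + 1) * (a ^ (2 * (m + 1)) * t)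
          + a ^ (2 * m)
            * (a ^ 2 * b ^ 2 + 4 * (m + 1) * t ^ 2 + 2 * (m + 1) * (t * b ^ 2)) := by
      rw [hsq]; ring
    have hleft : ‖z + w‖ ^ (2 * (m + 1 + 1)) = ‖z + w‖ ^ (2 * (m + 1)) * ‖z + w‖ ^ 2 := by ring
    have hright : 3 * ((m : ℝ) + 1 + 1) ^ 2 * b ^ 2 * (a + b) ^ (2 * (m + 1))
        = 3 * ((m : ℝ) + 1) ^ 2 * b ^ 2 * (a + b) ^ (2 * m) * (a + b) ^ 2
          + (a + b) ^ (2 * m) * ((6 * m + 9) * (b ^ 2 * (a + b) ^ 2)) := by ring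
    push_cast
    rw [hleft, hright]
    linarith

theorem add_pow_two_mul_le {x K : ℝ} (hx : 0 ≤ x) (hK : 0 ≤ K) (m : ℕ) :
    (x + K) ^ (2 * m) ≤ 2 ^ (2 * m) * (1 + K ^ (2 * m)) * (1 + x ^ (2 * (m + 1))) := by
  have hxpow : x ^ (2 * m) ≤ 1 + x ^ (2 * (m + 1)) := by
    rcases le_total x 1 with h | h
    · have := pow_le_one₀ (n := 2 * m) hx h
      have : 0 ≤ x ^ (2 * (m + 1)) := by positivity
      linarith
    · have := pow_le_pow_right₀ h (by omega : 2 * m ≤ 2 * (m + 1))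
      linarith
  have hKpow : 0 ≤ K ^ (2 * m) := by positivity
  have hxpow' : 0 ≤ x ^ (2 * (m + 1)) := by positivity
  calc (x + K) ^ (2 * m) ≤ 2 ^ (2 * m - 1) * (x ^ (2 * m) + K ^ (2 * m)) := add_pow_le hx hK _
    _ ≤ 2 ^ (2 * m) * (x ^ (2 * m) + K ^ (2 * m)) := by
        gcongr
        · norm_num
        · omega
    _ ≤ 2 ^ (2 * m) * ((1 + K ^ (2 * m)) * (1 + x ^ (2 * (m + 1)))) := by
        gcongr
        nlinarith
    _ = _ := by ring

section Measure

variable {Ω : Type*} [MeasurableSpace Ω] {μ : Measure Ω}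

theorem memLp_top_mul {g h : Ω → ℂ} (hg : MemLp g ∞ μ) (hh : MemLp h ∞ μ) :
    MemLp (fun ω => g ω * h ω) ∞ μ :=
  hh.mul hg

theorem memLp_top_conj {g : Ω → ℂ} (hg : MemLp g ∞ μ) :
    MemLp (fun ω => conj (g ω)) ∞ μ :=
  hg.star

theorem memLp_top_prod [IsFiniteMeasure μ] {ι : Type*} (s : Finset ι) {g : ι → Ω → ℂ}
    (hg : ∀ i, MemLp (g i) ∞ μ) : MemLp (fun ω => ∏ i ∈ s, g i ω) ∞ μ := by
  classical
  induction s using Finset.induction_on with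
  | empty => simpa using memLp_const (1 : ℂ)
  | insert i s hi ih =>
    simp only [Finset.prod_insert hi]
    exact memLp_top_mul (hg i) ih

theorem memLp_top_pow [IsFiniteMeasure μ] {g : Ω → ℂ} (hg : MemLp g ∞ μ) (n : ℕ) :
    MemLp (fun ω => g ω ^ n) ∞ μ := by
  simpa using memLp_top_prod (Finset.range n) (fun _ => hg)

theorem memLp_top_sum {f : ℕ → Ω → ℂ} (hf : ∀ i, MemLp (f i) ∞ μ) (c : ℕ → ℂ) (s : Finset ℕ) :
    MemLp (fun ω => ∑ k ∈ s, c k * f k ω) ∞ μ :=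
  memLp_finsetSum s fun k _ => (hf k).const_mul (c k)

theorem integrable_norm_pow [IsFiniteMeasure μ] {g : Ω → ℂ} (hg : MemLp g ∞ μ) (n : ℕ) :
    Integrable (fun ω => ‖g ω‖ ^ n) μ := by
  simpa using ((memLp_top_pow hg n).integrable le_top).norm

/-- A bounded orthonormal system tends weakly to zero, by Bessel's inequality. -/
theorem tendsto_integral_mul [IsFiniteMeasure μ] {f : ℕ → Ω → ℂ} (hf : ∀ i, MemLp (f i) ∞ μ)
    (horth : ∀ i j, ∫ ω, f i ω * conj (f j ω) ∂μ = if i = j then 1 else 0)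
    {h : Ω → ℂ} (hh : MemLp h ∞ μ) :
    Tendsto (fun i => ∫ ω, h ω * f i ω ∂μ) atTop (𝓝 0) := by
  have hf₂ : ∀ i, MemLp (f i) 2 μ := fun i => (hf i).mono_exponent le_top
  have hh₂ : MemLp (fun ω => conj (h ω)) 2 μ := (memLp_top_conj hh).mono_exponent le_top
  have hinner : ∀ i {g : Ω → ℂ} (hg : MemLp g 2 μ),
      inner ℂ ((hf₂ i).toLp (f i)) (hg.toLp g) = ∫ ω, g ω * conj (f i ω) ∂μ := by
    intro i g hg
    rw [L2.inner_def]
    refine integral_congr_ae ?_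
    filter_upwards [(hf₂ i).coeFn_toLp, hg.coeFn_toLp] with ω h₁ h₂
    rw [h₁, h₂, RCLike.inner_apply]
  have hON : Orthonormal ℂ fun i => (hf₂ i).toLp (f i) := by
    rw [orthonormal_iff_ite]
    intro i j
    rw [hinner, horth]
    simp only [eq_comm]
  have hsum := (hON.inner_products_summable (hh₂.toLp _)).tendsto_atTop_zero
  have hsqrt := (Real.continuous_sqrt.tendsto 0).comp hsum
  rw [Real.sqrt_zero] at hsqrt
  refine tendsto_zero_iff_norm_tendsto_zero.2 (hsqrt.congr fun i => ?_)
  rw [Function.comp_apply, Real.sqrt_sq (norm_nonneg _), hinner, ← RCLike.norm_conj,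
    ← integral_conj]
  simp

/-- The mixed moment `∫ f_{x₁} ⋯ f_{xₘ} \overline{f_{y₁} ⋯ f_{yₗ}} f_i dμ`. -/
noncomputable def mixedMoment (μ : Measure Ω) (f : ℕ → Ω → ℂ) {m l : ℕ}
    (x : Fin m → ℕ) (y : Fin l → ℕ) (i : ℕ) : ℂ :=
  ∫ ω, ((∏ j, f (x j) ω) * ∏ j, conj (f (y j) ω)) * f i ω ∂μ

theorem tendsto_mixedMoment [IsFiniteMeasure μ] {f : ℕ → Ω → ℂ} (hf : ∀ i, MemLp (f i) ∞ μ)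
    (horth : ∀ i j, ∫ ω, f i ω * conj (f j ω) ∂μ = if i = j then 1 else 0)
    {m l : ℕ} (x : Fin m → ℕ) (y : Fin l → ℕ) :
    Tendsto (mixedMoment μ f x y) atTop (𝓝 0) :=
  tendsto_integral_mul hf horth <| memLp_top_mul (memLp_top_prod _ fun j => hf (x j))
    (memLp_top_prod _ fun j => memLp_top_conj (hf (y j)))

/-- A subsequence along which the mixed moments with strictly largest last index are as small
as prescribed. -/
theorem exists_strictMono_mixedMoment_le [IsFiniteMeasure μ] {f : ℕ → Ω → ℂ}
    (hf : ∀ i, MemLp (f i) ∞ μ)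
    (horth : ∀ i j, ∫ ω, f i ω * conj (f j ω) ∂μ = if i = j then 1 else 0)
    (m l : ℕ) {ε : ℕ → ℝ} (hε : ∀ a, 0 < ε a) :
    ∃ φ : ℕ → ℕ, StrictMono φ ∧ ∀ (a : ℕ) (x : Fin m → ℕ) (y : Fin (l + 1) → ℕ),
      (∀ j, x j < a) → (∀ j, y j < a) →
        ‖mixedMoment μ (fun k => f (φ k)) x y a‖ ≤ ε a := by
  have hex : ∀ M a : ℕ, ∃ i, M < i ∧ ∀ (x : Fin m → Fin (M + 1)) (y : Fin (l + 1) → Fin (M + 1)),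
      ‖mixedMoment μ f (fun j => (x j : ℕ)) (fun j => (y j : ℕ)) i‖ ≤ ε a := by
    intro M a
    refine ((eventually_gt_atTop M).and (eventually_all.2 fun x => eventually_all.2 fun y =>
      ?_)).exists
    have := (tendsto_mixedMoment hf horth (fun j => (x j : ℕ)) (fun j => (y j : ℕ))).norm
    rw [norm_zero] at this
    exact this.eventually_le_const (hε a)
  choose next hlt hnext using hex
  let φ : ℕ → ℕ := fun k => Nat.rec 0 (fun k M => next M (k + 1)) k
  have hφ : StrictMono φ := strictMono_nat_of_lt_succ fun k => hlt _ _
  refine ⟨φ, hφ, fun a x y hx hy => ?_⟩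
  cases a with
  | zero => exact absurd (hy 0) (Nat.not_lt_zero _)
  | succ a =>
    have hle : ∀ k, k < a + 1 → φ k < φ a + 1 := fun k hk =>
      Nat.lt_succ_of_le (hφ.monotone (Nat.le_of_lt_succ hk))
    exact hnext (φ a) (a + 1) (fun j => ⟨φ (x j), hle _ (hx j)⟩)
      (fun j => ⟨φ (y j), hle _ (hy j)⟩)

/-- Expansion of the linear term of the moment recursion into mixed moments. -/
theorem norm_integral_pow_mul_le [IsFiniteMeasure μ] {g : ℕ → Ω → ℂ}
    (hg : ∀ i, MemLp (g i) ∞ μ) {m l : ℕ} {c : ℕ → ℂ} {s : Finset ℕ} {a : ℕ} {δ : ℝ}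
    (hc : ∀ k ∈ s, ‖c k‖ ≤ 1)
    (hδ : ∀ (x : Fin m → ℕ) (y : Fin l → ℕ), (∀ j, x j ∈ s) → (∀ j, y j ∈ s) →
      ‖mixedMoment μ g x y a‖ ≤ δ) :
    ‖∫ ω, ((∑ k ∈ s, c k * g k ω) ^ m * conj (∑ k ∈ s, c k * g k ω) ^ l) * g a ω ∂μ‖
      ≤ (s.card : ℝ) ^ (m + l) * δ := by
  have hexpand : ∀ ω, ((∑ k ∈ s, c k * g k ω) ^ m * conj (∑ k ∈ s, c k * g k ω) ^ l) * g a ω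
      = ∑ x ∈ Fintype.piFinset fun _ : Fin m => s, ∑ y ∈ Fintype.piFinset fun _ : Fin l => s,
        ((∏ j, c (x j)) * ∏ j, conj (c (y j)))
          * (((∏ j, g (x j) ω) * ∏ j, conj (g (y j) ω)) * g a ω) := by
    intro ω
    rw [map_sum, Finset.sum_pow', Finset.sum_pow', Finset.sum_mul_sum, Finset.sum_mul]
    refine Finset.sum_congr rfl fun x _ => ?_
    rw [Finset.sum_mul]
    refine Finset.sum_congr rfl fun y _ => ?_
    simp only [map_mul, Finset.prod_mul_distrib]
    ring
  have hint : ∀ (x : Fin m → ℕ) (y : Fin l → ℕ), Integrable (fun ω =>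
      ((∏ j, c (x j)) * ∏ j, conj (c (y j)))
          * (((∏ j, g (x j) ω) * ∏ j, conj (g (y j) ω)) * g a ω)) μ := fun x y =>
    ((memLp_top_mul (memLp_top_mul (memLp_top_prod _ fun j => hg (x j))
      (memLp_top_prod _ fun j => memLp_top_conj (hg (y j)))) (hg a)).integrable le_top).const_mul _
  simp only [hexpand]
  rw [integral_finsetSum _ fun x _ => integrable_finsetSum _ fun y _ => hint x y]
  have hterm : ∀ x ∈ Fintype.piFinset fun _ : Fin m => s,
      ‖∫ ω, ∑ y ∈ Fintype.piFinset fun _ : Fin l => s, ((∏ j, c (x j)) * ∏ j, conj (c (y j)))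
          * (((∏ j, g (x j) ω) * ∏ j, conj (g (y j) ω)) * g a ω) ∂μ‖
        ≤ (s.card : ℝ) ^ l * δ := by
    intro x hx
    rw [integral_finsetSum _ fun y _ => hint x y]
    refine (norm_sum_le_of_le (f := _) (n := fun _ => δ) _ fun y hy => ?_).trans_eq ?_
    · rw [Fintype.mem_piFinset] at hx hy
      rw [integral_const_mul, norm_mul]
      have hcoeff : ‖(∏ j, c (x j)) * ∏ j, conj (c (y j))‖ ≤ 1 := by
        rw [norm_mul, norm_prod, norm_prod]
        refine mul_le_one₀ (Finset.prod_le_one (fun _ _ => norm_nonneg _) fun j _ => hc _ (hx j))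
          (Finset.prod_nonneg fun _ _ => norm_nonneg _)
          (Finset.prod_le_one (fun _ _ => norm_nonneg _) fun j _ => ?_)
        rw [RCLike.norm_conj]
        exact hc _ (hy j)
      exact (mul_le_of_le_one_left (norm_nonneg _) hcoeff).trans (hδ x y hx hy)
    · simp
  refine (norm_sum_le_of_le _ hterm).trans_eq ?_
  simp only [Finset.sum_const, Fintype.card_piFinset_const, nsmul_eq_mul]
  push_cast
  ring

/-- Discrete Gronwall iteration for the even moments of the partial sums. -/
theorem one_add_integral_norm_sum_pow_le [IsProbabilityMeasure μ] {g : ℕ → Ω → ℂ}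
    (hg : ∀ i, MemLp (g i) ∞ μ) {K : ℝ} (hK : 0 ≤ K) (hbdd : ∀ i, ∀ᵐ ω ∂μ, ‖g i ω‖ ≤ K) {m : ℕ}
    (hmom : ∀ (a : ℕ) (x : Fin m → ℕ) (y : Fin (m + 1) → ℕ),
      (∀ j, x j < a) → (∀ j, y j < a) →
        ‖mixedMoment μ g x y a‖ ≤ (1 / 2) ^ a / ((a : ℝ) + 1) ^ (m + (m + 1)))
    {c : ℕ → ℂ} (s : Finset ℕ) (hc : ∀ k ∈ s, ‖c k‖ ≤ 1) :
    1 + ∫ ω, ‖∑ k ∈ s, c k * g k ω‖ ^ (2 * (m + 1)) ∂μ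
      ≤ Real.exp (∑ k ∈ s, (3 * (m + 1) ^ 2 * K ^ 2 * (2 ^ (2 * m) * (1 + K ^ (2 * m)))
          * ‖c k‖ ^ 2 + 2 * (m + 1) * (1 / 2) ^ k)) := by
  induction s using Finset.induction_on_max with
  | empty => simp
  | insert a s hlt ih =>
    have ha : a ∉ s := fun h => lt_irrefl a (hlt a h)
    have hca : ‖c a‖ ≤ 1 := hc a (Finset.mem_insert_self a s)
    have hcs : ∀ k ∈ s, ‖c k‖ ≤ 1 := fun k hk => hc k (Finset.mem_insert_of_mem hk)
    specialize ih hcs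
    set A : ℝ := 3 * (m + 1) ^ 2 * K ^ 2 * (2 ^ (2 * m) * (1 + K ^ (2 * m))) with hA
    set S : Ω → ℂ := fun ω => ∑ k ∈ s, c k * g k ω
    set I : ℂ := ∫ ω, (S ω ^ m * conj (S ω) ^ (m + 1)) * g a ω ∂μ with hI
    have hSmem : MemLp S ∞ μ := memLp_top_sum hg c s
    have hcard : s.card ≤ a := by
      simpa using Finset.card_le_card (fun k hk => Finset.mem_range.2 (hlt k hk) :
        s ⊆ Finset.range a)
    have hIle : ‖I‖ ≤ (1 / 2) ^ a := by
      refine (norm_integral_pow_mul_le hg hcs fun x y hx hy =>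
        hmom a x y (fun j => hlt _ (hx j)) fun j => hlt _ (hy j)).trans ?_
      rw [mul_div_left_comm]
      refine mul_le_of_le_one_right (by positivity) (div_le_one_of_le₀ ?_ (by positivity))
      gcongr
      exact_mod_cast hcard.trans (Nat.le_succ a)
    have hlin : Integrable (fun ω => c a * ((S ω ^ m * conj (S ω) ^ (m + 1)) * g a ω)) μ :=
      ((memLp_top_mul (memLp_top_mul (memLp_top_pow hSmem m)
        (memLp_top_pow (memLp_top_conj hSmem) (m + 1))) (hg a)).integrable le_top).const_mul _
    have hlinre : ∫ ω, (c a * ((S ω ^ m * conj (S ω) ^ (m + 1)) * g a ω)).re ∂μ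
        ≤ (1 / 2) ^ a := by
      have : ∫ ω, (c a * ((S ω ^ m * conj (S ω) ^ (m + 1)) * g a ω)).re ∂μ = (c a * I).re := by
        rw [hI, ← integral_const_mul]
        exact integral_re hlin
      rw [this]
      refine (Complex.re_le_norm _).trans ?_
      rw [norm_mul]
      exact (mul_le_of_le_one_left (norm_nonneg _) hca).trans hIle
    have hpow := integrable_norm_pow hSmem (2 * (m + 1))
    have hpoint : ∀ᵐ ω ∂μ, ‖∑ k ∈ insert a s, c k * g k ω‖ ^ (2 * (m + 1))
        ≤ ‖S ω‖ ^ (2 * (m + 1))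
          + 2 * (m + 1) * (c a * ((S ω ^ m * conj (S ω) ^ (m + 1)) * g a ω)).re
          + A * ‖c a‖ ^ 2 * (1 + ‖S ω‖ ^ (2 * (m + 1))) := by
      filter_upwards [hbdd a] with ω hω
      have hw : ‖c a * g a ω‖ ≤ ‖c a‖ * K := by rw [norm_mul]; gcongr
      have hwK : ‖c a * g a ω‖ ≤ K := hw.trans (mul_le_of_le_one_left hK hca)
      have hre : ‖S ω‖ ^ (2 * m) * (conj (S ω) * (c a * g a ω)).re
          = (c a * ((S ω ^ m * conj (S ω) ^ (m + 1)) * g a ω)).re := by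
        rw [← Complex.re_ofReal_mul]
        congr 1
        push_cast
        rw [pow_mul, ← Complex.mul_conj']
        ring
      rw [Finset.sum_insert ha, add_comm]
      refine (norm_add_pow_le (S ω) (c a * g a ω) m).trans ?_
      rw [hre]
      refine add_le_add le_rfl ?_
      calc 3 * ((m : ℝ) + 1) ^ 2 * ‖c a * g a ω‖ ^ 2 * (‖S ω‖ + ‖c a * g a ω‖) ^ (2 * m)
          ≤ 3 * ((m : ℝ) + 1) ^ 2 * (‖c a‖ * K) ^ 2 * (‖S ω‖ + K) ^ (2 * m) := by gcongr
        _ ≤ 3 * ((m : ℝ) + 1) ^ 2 * (‖c a‖ * K) ^ 2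
            * (2 ^ (2 * m) * (1 + K ^ (2 * m)) * (1 + ‖S ω‖ ^ (2 * (m + 1)))) := by
          gcongr
          exact add_pow_two_mul_le (norm_nonneg _) hK m
        _ = _ := by rw [hA]; ring
    have hre_int : Integrable (fun ω =>
        2 * ((m : ℝ) + 1) * (c a * ((S ω ^ m * conj (S ω) ^ (m + 1)) * g a ω)).re) μ :=
      hlin.re.const_mul _
    have hone : Integrable (fun ω => A * ‖c a‖ ^ 2 * (1 + ‖S ω‖ ^ (2 * (m + 1)))) μ :=
      ((integrable_const 1).add hpow).const_mul _
    have hstep := integral_mono_ae (integrable_norm_pow (memLp_top_sum hg c (insert a s)) _)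
      ((hpow.add hre_int).add hone) hpoint
    rw [integral_add' (hpow.add hre_int) hone, integral_add' hpow hre_int, integral_const_mul,
      integral_const_mul, integral_add (integrable_const _) hpow, integral_const, probReal_univ,
      one_smul] at hstep
    set u : ℝ := ∫ ω, ‖S ω‖ ^ (2 * (m + 1)) ∂μ
    have hu0 : 0 ≤ u := integral_nonneg fun ω => by positivity
    have hmlin := mul_le_mul_of_nonneg_left hlinre (by positivity : (0 : ℝ) ≤ 2 * (m + 1))
    have hB : 0 ≤ 2 * ((m : ℝ) + 1) * (1 / 2) ^ a := by positivity
    rw [Finset.sum_insert ha, Real.exp_add]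
    calc 1 + ∫ ω, ‖∑ k ∈ insert a s, c k * g k ω‖ ^ (2 * (m + 1)) ∂μ
        ≤ (A * ‖c a‖ ^ 2 + 2 * (m + 1) * (1 / 2) ^ a + 1) * (1 + u) := by
          nlinarith
      _ ≤ Real.exp (A * ‖c a‖ ^ 2 + 2 * (m + 1) * (1 / 2) ^ a) * (1 + u) := by
          gcongr
          exact Real.add_one_le_exp _
      _ ≤ _ := by gcongr

theorem sum_half_pow_le (s : Finset ℕ) : ∑ k ∈ s, (1 / 2 : ℝ) ^ k ≤ 2 :=
  (summable_geometric_two.sum_le_tsum s fun _ _ => by positivity).trans_eq tsum_geometric_two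

/-- A bound for coefficients in the unit ball of `ℓ²` extends to all coefficients by
homogeneity. -/
theorem eLpNorm_sum_le_of_unit_ball {g : ℕ → Ω → ℂ} {p : ℝ≥0∞} {C : ℝ}
    (hunit : ∀ (c : ℕ → ℂ) (s : Finset ℕ), ∑ k ∈ s, ‖c k‖ ^ 2 ≤ 1 →
      eLpNorm (fun ω => ∑ k ∈ s, c k * g k ω) p μ ≤ ENNReal.ofReal C)
    (c : ℕ → ℂ) (s : Finset ℕ) :
    eLpNorm (fun ω => ∑ k ∈ s, c k * g k ω) p μ
      ≤ ENNReal.ofReal (C * (∑ k ∈ s, ‖c k‖ ^ 2) ^ ((1 : ℝ) / 2)) := by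
  rw [← Real.sqrt_eq_rpow]
  set σ := √(∑ k ∈ s, ‖c k‖ ^ 2)
  have hσsq : σ ^ 2 = ∑ k ∈ s, ‖c k‖ ^ 2 := Real.sq_sqrt (by positivity)
  have hσ0 : 0 ≤ σ := Real.sqrt_nonneg _
  rcases hσ0.eq_or_lt with h0 | hpos
  · have hzero : ∀ k ∈ s, c k = 0 := by
      rw [← h0, eq_comm, zero_pow two_ne_zero,
        Finset.sum_eq_zero_iff_of_nonneg fun _ _ => by positivity] at hσsq
      exact fun k hk => by simpa using hσsq k hk
    have : (fun ω => ∑ k ∈ s, c k * g k ω) = 0 := by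
      funext ω
      exact Finset.sum_eq_zero fun k hk => by rw [hzero k hk, zero_mul]
    simp [this]
  · have hσne : (σ : ℂ) ≠ 0 := by exact_mod_cast hpos.ne'
    have hscale : (fun ω => ∑ k ∈ s, c k * g k ω)
        = (σ : ℂ) • fun ω => ∑ k ∈ s, (c k / σ) * g k ω := by
      funext ω
      rw [Pi.smul_apply, smul_eq_mul, Finset.mul_sum]
      refine Finset.sum_congr rfl fun k _ => ?_
      field_simp
    have hball : ∑ k ∈ s, ‖c k / σ‖ ^ 2 ≤ 1 := by
      simp only [norm_div, div_pow, Complex.norm_real, Real.norm_eq_abs, sq_abs]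
      rw [← Finset.sum_div, ← hσsq, div_self (by positivity)]
    rw [hscale, eLpNorm_const_smul, mul_comm C, ENNReal.ofReal_mul hpos.le]
    gcongr
    · rw [← ofReal_norm, Complex.norm_real, Real.norm_of_nonneg hpos.le]
    · exact hunit _ s hball

theorem eLpNorm_le_of_integral_norm_pow_le [IsProbabilityMeasure μ] {g : Ω → ℂ}
    (hg : MemLp g ∞ μ) {p C : ℝ} {n : ℕ} (hn : n ≠ 0) (hpn : p ≤ n) (hC : 1 ≤ C)
    (hint : ∫ ω, ‖g ω‖ ^ n ∂μ ≤ C) :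
    eLpNorm g (ENNReal.ofReal p) μ ≤ ENNReal.ofReal C := by
  have hle : ENNReal.ofReal p ≤ n := by
    rw [← ENNReal.ofReal_natCast]
    exact ENNReal.ofReal_le_ofReal hpn
  refine (eLpNorm_le_eLpNorm_of_exponent_le hle hg.1).trans ?_
  rw [(hg.mono_exponent le_top).eLpNorm_eq_integral_rpow_norm (by exact_mod_cast hn)
    (ENNReal.natCast_ne_top n)]
  refine ENNReal.ofReal_le_ofReal ?_
  simp only [ENNReal.toReal_natCast, Real.rpow_natCast]
  have hinv : (n : ℝ)⁻¹ ≤ 1 := inv_le_one_of_one_le₀ (by exact_mod_cast Nat.one_le_iff_ne_zero.2 hn)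
  calc (∫ ω, ‖g ω‖ ^ n ∂μ) ^ (n : ℝ)⁻¹ ≤ C ^ (n : ℝ)⁻¹ :=
        Real.rpow_le_rpow (integral_nonneg fun _ => by positivity) hint (by positivity)
    _ ≤ C ^ (1 : ℝ) := Real.rpow_le_rpow_of_exponent_le hC hinv
    _ = C := Real.rpow_one C

end Measure

end LambdaP

/-- Kaczmarz–Steinhaus: every uniformly bounded orthonormal system `(fᵢ)` in `L²` of a
probability space contains, for each `2 < p < ∞`, an infinite subsystem `(f_{i_k})` which is
a Λ(p)-system: `‖∑ c_k f_{i_k}‖_p ≤ C (∑ |c_k|²)^{1/2}`. -/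
theorem exists_lambda_p_subsystem {Ω : Type*} [MeasurableSpace Ω] (μ : Measure Ω)
    [IsProbabilityMeasure μ]
    (f : ℕ → Ω → ℂ) (hmeas : ∀ i, AEStronglyMeasurable (f i) μ)
    (horth : ∀ i j, ∫ ω, f i ω * (starRingEnd ℂ) (f j ω) ∂μ = if i = j then 1 else 0)
    (K : ℝ) (hbdd : ∀ i, ∀ᵐ ω ∂μ, ‖f i ω‖ ≤ K) :
    ∀ p : ℝ, 2 < p →
      ∃ φ : ℕ → ℕ, StrictMono φ ∧ ∃ C : ℝ, 0 < C ∧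
        ∀ (c : ℕ → ℂ) (s : Finset ℕ),
          eLpNorm (fun ω => ∑ k ∈ s, c k * f (φ k) ω) (ENNReal.ofReal p) μ
            ≤ ENNReal.ofReal (C * (∑ k ∈ s, ‖c k‖ ^ 2) ^ ((1 : ℝ) / 2)) := by
  intro p hp
  have hf : ∀ i, MemLp (f i) ∞ μ := fun i => memLp_top_of_bound (hmeas i) K (hbdd i)
  have hK : 0 ≤ K := by
    obtain ⟨ω, hω⟩ := (hbdd 0).exists
    exact (norm_nonneg _).trans hω
  set m : ℕ := ⌈p⌉₊
  obtain ⟨φ, hφ, hmom⟩ := LambdaP.exists_strictMono_mixedMoment_le hf horth m m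
    (ε := fun a => (1 / 2) ^ a / ((a : ℝ) + 1) ^ (m + (m + 1))) fun a => by positivity
  set A : ℝ := 3 * (m + 1) ^ 2 * K ^ 2 * (2 ^ (2 * m) * (1 + K ^ (2 * m))) with hA
  have hA0 : 0 ≤ A := by positivity
  refine ⟨φ, hφ, Real.exp (A + 2 * (m + 1) * 2), Real.exp_pos _,
    LambdaP.eLpNorm_sum_le_of_unit_ball fun c s hcs => ?_⟩
  have hc : ∀ k ∈ s, ‖c k‖ ≤ 1 := fun k hk =>
    (sq_le_one_iff₀ (norm_nonneg _)).1 <|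
      (Finset.single_le_sum (f := fun k => ‖c k‖ ^ 2) (fun _ _ => by positivity) hk).trans hcs
  refine LambdaP.eLpNorm_le_of_integral_norm_pow_le (n := 2 * (m + 1))
    (LambdaP.memLp_top_sum (fun k => hf (φ k)) c s) (by omega) ?_
    (Real.one_le_exp (by positivity)) ?_
  · have := Nat.le_ceil p
    push_cast
    linarith [(Nat.cast_nonneg m : (0 : ℝ) ≤ m)]
  · have hmoment := LambdaP.one_add_integral_norm_sum_pow_le (fun k => hf (φ k)) hK
      (fun k => hbdd (φ k)) hmom s hc
    rw [Finset.sum_add_distrib, ← Finset.mul_sum, ← Finset.mul_sum, ← hA] at hmoment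
    refine (le_add_of_nonneg_left zero_le_one).trans (hmoment.trans (Real.exp_le_exp.2 ?_))
    gcongr
    · exact mul_le_of_le_one_right hA0 hcs
    · exact LambdaP.sum_half_pow_le s
end
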